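/- If D₁ ⊆ N and D₂ ⊆ N are both weakly decodable, then their union D₁ ∪ D₂ is also weakly decodable. -/

import Mathlib

open scoped BigOperators

/-- Shannon entropy (natural log) of a random variable `X` on a finite sample
space `Ω` with probability mass function `μ`. -/
noncomputable def entropy {Ω α : Type*} [Fintype Ω] [Fintype α] [DecidableEq α]
    (μ : Ω → ℝ) (X : Ω → α) : ℝ :=
  ∑ a : α, Real.negMulLog (∑ ω ∈ Finset.univ.filter (fun ω => X ω = a), μ ω)

/-- Conditional mutual information `I(X;Y|Z)` for random variables on a finite
sample space with pmf `μ`. -/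
noncomputable def condMI {Ω α β γ : Type*} [Fintype Ω]
    [Fintype α] [DecidableEq α] [Fintype β] [DecidableEq β] [Fintype γ] [DecidableEq γ]
    (μ : Ω → ℝ) (X : Ω → α) (Y : Ω → β) (Z : Ω → γ) : ℝ :=
  entropy μ (fun ω => (X ω, Z ω)) + entropy μ (fun ω => (Y ω, Z ω))
    - entropy μ (fun ω => (X ω, Y ω, Z ω)) - entropy μ Z

/-- Sample space for the compress-and-forward multiple-relay channel:
a value of `(x₀, (xᵢ)ᵢ, (yᵢ)ᵢ, y_{n+1}, (ŷᵢ)ᵢ)`. -/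
abbrev CFOmega {n : ℕ} (X0A : Type) (XA YA : Fin n → Type) (YdA : Type)
    (YhA : Fin n → Type) : Type :=
  X0A × (∀ i, XA i) × (∀ i, YA i) × YdA × (∀ i, YhA i)

section CF

variable {n : ℕ} {X0A YdA : Type} {XA YA YhA : Fin n → Type}

/-- The source input `X₀`. -/
def rvX0 : CFOmega X0A XA YA YdA YhA → X0A := fun ω => ω.1

/-- The tuple of relay inputs `X_S = (Xᵢ)_{i∈S}`. -/
def rvXS (S : Finset (Fin n)) : CFOmega X0A XA YA YdA YhA → (∀ i : S, XA i) :=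
  fun ω i => ω.2.1 i

/-- The tuple of relay outputs `Y_S = (Yᵢ)_{i∈S}`. -/
def rvYS (S : Finset (Fin n)) : CFOmega X0A XA YA YdA YhA → (∀ i : S, YA i) :=
  fun ω i => ω.2.2.1 i

/-- The destination output `Y_{n+1}`. -/
def rvYd : CFOmega X0A XA YA YdA YhA → YdA := fun ω => ω.2.2.2.1

/-- The tuple of compressions `Ŷ_S = (Ŷᵢ)_{i∈S}`. -/
def rvYhS (S : Finset (Fin n)) : CFOmega X0A XA YA YdA YhA → (∀ i : S, YhA i) :=
  fun ω i => ω.2.2.2.2 i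

/-- The joint pmf
`p(x₀)·∏ᵢ p(xᵢ) · p(y₁,…,y_{n+1}|x₀,…,x_n) · ∏ᵢ p(ŷᵢ|yᵢ,xᵢ)`. -/
noncomputable def muCF (p0 : X0A → ℝ) (pX : ∀ i, XA i → ℝ)
    (W : X0A → (∀ i, XA i) → ((∀ i, YA i) × YdA) → ℝ)
    (κ : ∀ i, YA i → XA i → YhA i → ℝ) :
    CFOmega X0A XA YA YdA YhA → ℝ :=
  fun ω => p0 ω.1 * (∏ i, pX i (ω.2.1 i)) * W ω.1 ω.2.1 (ω.2.2.1, ω.2.2.2.1)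
    * ∏ i, κ i (ω.2.2.1 i) (ω.2.1 i) (ω.2.2.2.2 i)

variable [Fintype X0A] [DecidableEq X0A] [Fintype YdA] [DecidableEq YdA]
  [∀ i, Fintype (XA i)] [∀ i, DecidableEq (XA i)]
  [∀ i, Fintype (YA i)] [∀ i, DecidableEq (YA i)]
  [∀ i, Fintype (YhA i)] [∀ i, DecidableEq (YhA i)]

/-- `I(X_S; Ŷ_{D∖S}, Y_{n+1} | X_0, X_{D∖S}) − I(Y_S; Ŷ_S | X_0, X_D, Y_{n+1}, Ŷ_{D∖S})`. -/
noncomputable def cfGap (μ : CFOmega X0A XA YA YdA YhA → ℝ) (D S : Finset (Fin n)) : ℝ :=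
  condMI μ (rvXS S) (fun ω => (rvYhS (D \ S) ω, rvYd ω))
    (fun ω => (rvX0 ω, rvXS (D \ S) ω))
  - condMI μ (rvYS S) (rvYhS S)
    (fun ω => (rvX0 ω, rvXS D ω, rvYd ω, rvYhS (D \ S) ω))

/-- `D ⊆ N` is weakly decodable if for every `S ⊆ D`,
`I(X_S; Ŷ_{D∖S}, Y_{n+1} | X_0, X_{D∖S}) − I(Y_S; Ŷ_S | X_0, X_D, Y_{n+1}, Ŷ_{D∖S}) ≥ 0`. -/
def WeaklyDecodable (μ : CFOmega X0A XA YA YdA YhA → ℝ) (D : Finset (Fin n)) : Prop :=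
  ∀ S ⊆ D, 0 ≤ cfGap μ D S

end CF

/-- The mass of the level set of `X` through `ω`. -/
noncomputable def fiberMass {Ω α : Type*} [Fintype Ω] [DecidableEq α]
    (μ : Ω → ℝ) (X : Ω → α) (ω : Ω) : ℝ :=
  ∑ ω' ∈ Finset.univ.filter (fun ω' => X ω' = X ω), μ ω'

theorem le_fiberMass {Ω α : Type*} [Fintype Ω] [DecidableEq α] {μ : Ω → ℝ}
    (hμ : ∀ ω, 0 ≤ μ ω) (X : Ω → α) (ω : Ω) : μ ω ≤ fiberMass μ X ω :=
  Finset.single_le_sum (f := μ) (fun ω' _ => hμ ω') (by simp)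

section Entropy

variable {Ω α β γ ι : Type*} [Fintype Ω] [Fintype α] [DecidableEq α] [Fintype β] [DecidableEq β]
  [Fintype γ] [DecidableEq γ]

theorem sum_mul_comp (μ : Ω → ℝ) (X : Ω → α) (g : α → ℝ) :
    ∑ ω, μ ω * g (X ω) = ∑ a, (∑ ω ∈ Finset.univ.filter (fun ω => X ω = a), μ ω) * g a := by
  rw [← Finset.sum_fiberwise Finset.univ X]
  refine Finset.sum_congr rfl fun a _ => ?_
  rw [Finset.sum_mul]
  refine Finset.sum_congr rfl fun ω hω => ?_
  rw [(Finset.mem_filter.mp hω).2]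

theorem entropy_eq_neg_sum (μ : Ω → ℝ) (X : Ω → α) :
    entropy μ X = -∑ ω, μ ω * Real.log (fiberMass μ X ω) := by
  have h := sum_mul_comp μ X
    (fun a => Real.log (∑ ω' ∈ Finset.univ.filter (fun ω' => X ω' = a), μ ω'))
  simp only [fiberMass, entropy, Real.negMulLog, neg_mul, Finset.sum_neg_distrib]
  rw [h]

theorem entropy_congr (μ : Ω → ℝ) {X : Ω → α} {Y : Ω → β}
    (h : ∀ ω ω', X ω = X ω' ↔ Y ω = Y ω') : entropy μ X = entropy μ Y := by
  simp only [entropy_eq_neg_sum, fiberMass, h]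

theorem entropy_eq_sub_of_fiberMass_eq_mul_prod {μ : Ω → ℝ} (hμ : ∀ ω, 0 ≤ μ ω)
    {T : Ω → α} {U : Ω → β} (S : Finset ι) (k : ι → Ω → ℝ)
    (h : ∀ ω, fiberMass μ U ω = fiberMass μ T ω * ∏ i ∈ S, k i ω) :
    entropy μ U = entropy μ T - ∑ i ∈ S, ∑ ω, μ ω * Real.log (k i ω) := by
  rw [entropy_eq_neg_sum, entropy_eq_neg_sum, Finset.sum_comm, ← neg_add', neg_inj,
    ← Finset.sum_add_distrib]
  refine Finset.sum_congr rfl fun ω _ => ?_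
  rcases (hμ ω).eq_or_lt with h0 | h0
  · simp [← h0]
  · have hU : fiberMass μ T ω * ∏ i ∈ S, k i ω ≠ 0 :=
      h ω ▸ (h0.trans_le (le_fiberMass hμ U ω)).ne'
    rw [h, Real.log_mul (left_ne_zero_of_mul hU) (right_ne_zero_of_mul hU),
      Real.log_prod (Finset.prod_ne_zero_iff.mp (right_ne_zero_of_mul hU)), mul_add,
      Finset.mul_sum]

theorem sub_le_mul_log_add_log {q r s t : ℝ} (hq : 0 ≤ q) (hr : q ≤ r) (hs : q ≤ s) (ht : q ≤ t) :
    q - r * s / t ≤ q * (Real.log q + Real.log t - Real.log r - Real.log s) := by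
  rcases hq.eq_or_lt with h0 | h0
  · subst h0
    simpa using div_nonneg (mul_nonneg hr hs) ht
  · have hr0 := h0.trans_le hr
    have hs0 := h0.trans_le hs
    have ht0 := h0.trans_le ht
    have h1 := Real.log_le_sub_one_of_pos (x := r * s / (q * t)) (by positivity)
    rw [Real.log_div (by positivity) (by positivity), Real.log_mul hr0.ne' hs0.ne',
      Real.log_mul h0.ne' ht0.ne'] at h1
    have h2 := mul_le_mul_of_nonneg_left h1 hq
    have h3 : q * (r * s / (q * t) - 1) = r * s / t - q := by field_simp
    linarith

theorem condMI_nonneg {μ : Ω → ℝ} (hμ : ∀ ω, 0 ≤ μ ω) (X : Ω → α) (Y : Ω → β) (Z : Ω → γ) :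
    0 ≤ condMI μ X Y Z := by
  set q : α × β × γ → ℝ := fun p => ∑ ω with (X ω, Y ω, Z ω) = p, μ ω with hq
  set r : α × γ → ℝ := fun p => ∑ ω with (X ω, Z ω) = p, μ ω with hr
  set s : β × γ → ℝ := fun p => ∑ ω with (Y ω, Z ω) = p, μ ω with hs
  set t : γ → ℝ := fun c => ∑ ω with Z ω = c, μ ω with ht
  have hle : ∀ {A B : Ω → Prop} [DecidablePred A] [DecidablePred B], (∀ ω, A ω → B ω) →
      ∑ ω with A ω, μ ω ≤ ∑ ω with B ω, μ ω := fun hAB =>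
    Finset.sum_le_sum_of_subset_of_nonneg (Finset.monotone_filter_right _ fun ω _ => hAB ω)
      fun ω _ _ => hμ ω
  have hsumr : ∀ c, ∑ a, r (a, c) = t c := fun c => by
    simp only [hr, ht, Prod.mk.injEq]
    rw [← Finset.sum_fiberwise _ X]
    simp only [Finset.filter_filter, and_comm]
  have hsums : ∀ c, ∑ b, s (b, c) = t c := fun c => by
    simp only [hs, ht, Prod.mk.injEq]
    rw [← Finset.sum_fiberwise _ Y]
    simp only [Finset.filter_filter, and_comm]
  have hqt : ∑ p, q p = ∑ c, t c := by
    simp only [hq, ht, Finset.sum_fiberwise]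
  have hrst : ∑ p : α × β × γ, r (p.1, p.2.2) * s p.2 / t p.2.2 = ∑ c, t c := by
    simp only [Fintype.sum_prod_type]
    rw [Finset.sum_congr rfl fun a _ => Finset.sum_comm, Finset.sum_comm]
    refine Finset.sum_congr rfl fun c _ => ?_
    simp only [← Finset.sum_div, ← Finset.mul_sum, ← Finset.sum_mul, hsumr, hsums,
      mul_self_div_self]
  have hlog : condMI μ X Y Z = ∑ p : α × β × γ, q p *
      (Real.log (q p) + Real.log (t p.2.2) - Real.log (r (p.1, p.2.2)) - Real.log (s p.2)) := by
    rw [hq, ← sum_mul_comp μ (fun ω => (X ω, Y ω, Z ω))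
      (fun p => Real.log (q p) + Real.log (t p.2.2) - Real.log (r (p.1, p.2.2))
        - Real.log (s p.2))]
    simp only [condMI, entropy_eq_neg_sum, mul_sub, mul_add, Finset.sum_sub_distrib,
      Finset.sum_add_distrib]
    simp only [fiberMass, hq, hr, hs, ht]
    ring
  rw [hlog]
  calc (0 : ℝ) = ∑ p : α × β × γ, (q p - r (p.1, p.2.2) * s p.2 / t p.2.2) := by
        rw [Finset.sum_sub_distrib, hqt, hrst, sub_self]
    _ ≤ _ := Finset.sum_le_sum fun p _ => sub_le_mul_log_add_log
        (Finset.sum_nonneg fun ω _ => hμ ω)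
        (hle fun ω h => by rw [← h])
        (hle fun ω h => by rw [← h])
        (hle fun ω h => by rw [← h])

end Entropy

section Channel

set_option synthInstance.maxSize 1024
set_option synthInstance.maxHeartbeats 200000

variable {n : ℕ} {X0A YdA : Type} {XA YA YhA : Fin n → Type}
  {p0 : X0A → ℝ} {pX : ∀ i, XA i → ℝ}
  {W : X0A → (∀ i, XA i) → ((∀ i, YA i) × YdA) → ℝ}
  {κ : ∀ i, YA i → XA i → YhA i → ℝ}

theorem muCF_nonneg (hp0 : ∀ x, 0 ≤ p0 x) (hpX : ∀ i x, 0 ≤ pX i x)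
    (hW : ∀ x0 x y, 0 ≤ W x0 x y) (hκ : ∀ i y x yh, 0 ≤ κ i y x yh)
    (ω : CFOmega X0A XA YA YdA YhA) : 0 ≤ muCF p0 pX W κ ω :=
  mul_nonneg (mul_nonneg (mul_nonneg (hp0 _) (Finset.prod_nonneg fun i _ => hpX i _)) (hW _ _ _))
    (Finset.prod_nonneg fun i _ => hκ i _ _ _)

theorem sum_prod_of_agree {A : Fin n → Type} [∀ i, Fintype (A i)] [∀ i, DecidableEq (A i)]
    (f : ∀ i, A i → ℝ) (hf : ∀ i, ∑ a, f i a = 1) (T : Finset (Fin n)) (b : ∀ i, A i) :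
    (∑ a : ∀ i, A i, if ∀ i ∈ T, a i = b i then ∏ i, f i (a i) else 0) = ∏ i ∈ T, f i (b i) := by
  have h : ∀ a : ∀ i, A i, (if ∀ i ∈ T, a i = b i then ∏ i, f i (a i) else 0)
      = ∏ i, if i ∈ T → a i = b i then f i (a i) else 0 := fun a => by
    rw [Finset.prod_ite_zero]
    simp
  simp only [h]
  rw [← Fintype.prod_sum fun i c => if i ∈ T → c = b i then f i c else 0,
    ← Finset.prod_filter_mul_prod_filter_not Finset.univ (· ∈ T)]
  rw [Finset.prod_eq_one (s := Finset.univ.filter (· ∉ T))]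
  · simp only [Finset.filter_mem_eq_inter, Finset.univ_inter, mul_one]
    refine Finset.prod_congr rfl fun i hi => ?_
    simp [hi]
  · intro i hi
    simp only [Finset.mem_filter, Finset.mem_univ, true_and] at hi
    simp [hi, hf]

variable [Fintype X0A] [DecidableEq X0A] [Fintype YdA] [DecidableEq YdA]
  [∀ i, Fintype (XA i)] [∀ i, DecidableEq (XA i)]
  [∀ i, Fintype (YA i)] [∀ i, DecidableEq (YA i)]
  [∀ i, Fintype (YhA i)] [∀ i, DecidableEq (YhA i)]

theorem sum_muCF_marginal (hκs : ∀ i y x, ∑ yh, κ i y x yh = 1)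
    (Q : X0A → (∀ i, XA i) → (∀ i, YA i) → YdA → Prop) [∀ a b c d, Decidable (Q a b c d)]
    (T : Finset (Fin n)) (b : ∀ i, YhA i) :
    (∑ ω : CFOmega X0A XA YA YdA YhA with
        Q ω.1 ω.2.1 ω.2.2.1 ω.2.2.2.1 ∧ ∀ i ∈ T, ω.2.2.2.2 i = b i, muCF p0 pX W κ ω)
      = ∑ x0, ∑ x, ∑ y, ∑ yd, if Q x0 x y yd then
          p0 x0 * (∏ i, pX i (x i)) * W x0 x (y, yd) * ∏ i ∈ T, κ i (y i) (x i) (b i) else 0 := by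
  simp only [Finset.sum_filter, Fintype.sum_prod_type, muCF]
  refine Finset.sum_congr rfl fun x0 _ => Finset.sum_congr rfl fun x _ =>
    Finset.sum_congr rfl fun y _ => Finset.sum_congr rfl fun yd _ => ?_
  by_cases hQ : Q x0 x y yd
  · simp only [hQ, true_and, if_true]
    rw [← sum_prod_of_agree (fun i => κ i (y i) (x i)) (fun i => hκs i _ _) T b, Finset.mul_sum]
    exact Finset.sum_congr rfl fun a _ => by rw [mul_ite, mul_zero]
  · simp [hQ]

theorem fiberMass_inputs (hpXs : ∀ i, ∑ x, pX i x = 1)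
    (hWs : ∀ x0 x, ∑ y, W x0 x y = 1) (hκs : ∀ i y x, ∑ yh, κ i y x yh = 1)
    (A : Finset (Fin n)) (ω : CFOmega X0A XA YA YdA YhA) :
    fiberMass (muCF p0 pX W κ) (fun ω => (rvX0 ω, rvXS A ω)) ω
      = p0 ω.1 * ∏ i ∈ A, pX i (ω.2.1 i) := by
  have h := sum_muCF_marginal (p0 := p0) (pX := pX) (W := W) hκs
    (fun x0 x _ _ => x0 = ω.1 ∧ ∀ i ∈ A, x i = ω.2.1 i) ∅ ω.2.2.2.2
  simp only [fiberMass, rvX0, rvXS, Prod.mk.injEq, funext_iff, Subtype.forall]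
  simp only [Finset.notMem_empty, false_imp_iff, implies_true, and_true, Finset.prod_empty,
    mul_one] at h
  rw [h, ← sum_prod_of_agree pX hpXs A ω.2.1, Finset.mul_sum, Finset.sum_comm]
  refine Finset.sum_congr rfl fun x _ => ?_
  rw [Finset.sum_eq_single ω.1 (fun x0 _ hx0 => by simp [hx0]) (by simp)]
  by_cases hx : ∀ i ∈ A, x i = ω.2.1 i
  · have hW' := hWs ω.1 x
    rw [Fintype.sum_prod_type] at hW'
    simp only [if_pos hx, if_pos (And.intro trivial hx), ← Finset.mul_sum, hW', mul_one]
  · simp [hx]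

theorem fiberMass_compressions (hκs : ∀ i y x, ∑ yh, κ i y x yh = 1)
    {D S : Finset (Fin n)} (hS : S ⊆ D) (ω : CFOmega X0A XA YA YdA YhA) :
    fiberMass (muCF p0 pX W κ)
        (fun ω => (rvYS S ω, rvYhS S ω, rvX0 ω, rvXS D ω, rvYd ω, rvYhS (D \ S) ω)) ω
      = fiberMass (muCF p0 pX W κ)
          (fun ω => (rvYS S ω, rvX0 ω, rvXS D ω, rvYd ω, rvYhS (D \ S) ω)) ω
        * ∏ i ∈ S, κ i (ω.2.2.1 i) (ω.2.1 i) (ω.2.2.2.2 i) := by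
  set Q : X0A → (∀ i, XA i) → (∀ i, YA i) → YdA → Prop := fun x0 x y yd =>
    (∀ i ∈ S, y i = ω.2.2.1 i) ∧ x0 = ω.1 ∧ (∀ i ∈ D, x i = ω.2.1 i) ∧ yd = ω.2.2.2.1 with hQ
  have h1 := sum_muCF_marginal (p0 := p0) (pX := pX) (W := W) hκs Q D ω.2.2.2.2
  have h2 := sum_muCF_marginal (p0 := p0) (pX := pX) (W := W) hκs Q (D \ S) ω.2.2.2.2
  have e1 : fiberMass (muCF p0 pX W κ)
      (fun ω => (rvYS S ω, rvYhS S ω, rvX0 ω, rvXS D ω, rvYd ω, rvYhS (D \ S) ω)) ω = _ :=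
    Eq.trans (Finset.sum_congr (Finset.filter_congr fun ω' _ => by
      simp only [hQ, rvX0, rvXS, rvYS, rvYd, rvYhS, Prod.mk.injEq, funext_iff, Subtype.forall,
        Finset.mem_sdiff]
      grind) fun _ _ => rfl) h1
  have e2 : fiberMass (muCF p0 pX W κ)
      (fun ω => (rvYS S ω, rvX0 ω, rvXS D ω, rvYd ω, rvYhS (D \ S) ω)) ω = _ :=
    Eq.trans (Finset.sum_congr (Finset.filter_congr fun ω' _ => by
      simp only [hQ, rvX0, rvXS, rvYS, rvYd, rvYhS, Prod.mk.injEq, funext_iff, Subtype.forall,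
        Finset.mem_sdiff]
      grind) fun _ _ => rfl) h2
  rw [e1, e2]
  simp only [Finset.sum_mul]
  refine Finset.sum_congr rfl fun x0 _ => Finset.sum_congr rfl fun x _ =>
    Finset.sum_congr rfl fun y _ => Finset.sum_congr rfl fun yd _ => ?_
  split_ifs with h
  · rw [← Finset.prod_sdiff hS, ← mul_assoc]
    congr 1
    exact Finset.prod_congr rfl fun i hi => by rw [h.1 i hi, h.2.2.1 i (hS hi)]
  · simp

/-- The joint entropy of `X₀, Y_{n+1}, X_A, Ŷ_A`. -/
noncomputable def decodedEntropy (μ : CFOmega X0A XA YA YdA YhA → ℝ) (A : Finset (Fin n)) : ℝ :=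
  entropy μ (fun ω => (rvX0 ω, rvYd ω, rvXS A ω, rvYhS A ω))

theorem decodedEntropy_union_add_inter_le {μ : CFOmega X0A XA YA YdA YhA → ℝ}
    (hμ : ∀ ω, 0 ≤ μ ω) (A B : Finset (Fin n)) :
    decodedEntropy μ (A ∪ B) + decodedEntropy μ (A ∩ B)
      ≤ decodedEntropy μ A + decodedEntropy μ B := by
  have h := condMI_nonneg hμ (fun ω => (rvXS A ω, rvYhS A ω)) (fun ω => (rvXS B ω, rvYhS B ω))
    (fun ω => (rvX0 ω, rvYd ω, rvXS (A ∩ B) ω, rvYhS (A ∩ B) ω))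
  unfold condMI at h
  rw [entropy_congr μ (Y := fun ω => (rvX0 ω, rvYd ω, rvXS A ω, rvYhS A ω)),
    entropy_congr μ (X := fun ω => ((rvXS B ω, rvYhS B ω), _))
      (Y := fun ω => (rvX0 ω, rvYd ω, rvXS B ω, rvYhS B ω)),
    entropy_congr μ (X := fun ω => ((rvXS A ω, rvYhS A ω), (rvXS B ω, rvYhS B ω), _))
      (Y := fun ω => (rvX0 ω, rvYd ω, rvXS (A ∪ B) ω, rvYhS (A ∪ B) ω))] at h
  · unfold decodedEntropy
    linarith
  all_goals
    intro ω ω'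
    simp only [rvX0, rvXS, rvYd, rvYhS, Prod.mk.injEq, funext_iff, Subtype.forall,
      Finset.mem_union, Finset.mem_inter]
    grind

theorem cfGap_eq (hp0 : ∀ x, 0 ≤ p0 x) (hpX : ∀ i x, 0 ≤ pX i x)
    (hpXs : ∀ i, ∑ x, pX i x = 1) (hW : ∀ x0 x y, 0 ≤ W x0 x y)
    (hWs : ∀ x0 x, ∑ y, W x0 x y = 1) (hκ : ∀ i y x yh, 0 ≤ κ i y x yh)
    (hκs : ∀ i y x, ∑ yh, κ i y x yh = 1) {D S : Finset (Fin n)} (hS : S ⊆ D) :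
    cfGap (muCF p0 pX W κ) D S
      = decodedEntropy (muCF p0 pX W κ) (D \ S) - decodedEntropy (muCF p0 pX W κ) D
        - ∑ i ∈ S, ∑ ω, muCF p0 pX W κ ω * Real.log (pX i (ω.2.1 i))
        - ∑ i ∈ S, ∑ ω, muCF p0 pX W κ ω *
            Real.log (κ i (ω.2.2.1 i) (ω.2.1 i) (ω.2.2.2.2 i)) := by
  have hμ := muCF_nonneg hp0 hpX hW hκ
  have hX := entropy_eq_sub_of_fiberMass_eq_mul_prod hμ (T := fun ω => (rvX0 ω, rvXS (D \ S) ω))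
    (U := fun ω => (rvX0 ω, rvXS D ω)) S (fun i ω => pX i (ω.2.1 i)) fun ω => by
      rw [fiberMass_inputs hpXs hWs hκs, fiberMass_inputs hpXs hWs hκs, mul_assoc,
        Finset.prod_sdiff hS]
  have hY := entropy_eq_sub_of_fiberMass_eq_mul_prod hμ S
    (fun i ω => κ i (ω.2.2.1 i) (ω.2.1 i) (ω.2.2.2.2 i))
    (fiberMass_compressions (p0 := p0) (pX := pX) (W := W) hκs hS)
  set μ := muCF p0 pX W κ
  have e1 : entropy μ (fun ω => (rvXS S ω, rvX0 ω, rvXS (D \ S) ω))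
      = entropy μ (fun ω => (rvX0 ω, rvXS D ω)) := entropy_congr μ fun ω ω' => by
    simp only [rvX0, rvXS, Prod.mk.injEq, funext_iff, Subtype.forall, Finset.mem_sdiff]
    grind
  have e2 : entropy μ (fun ω => ((rvYhS (D \ S) ω, rvYd ω), rvX0 ω, rvXS (D \ S) ω))
      = decodedEntropy μ (D \ S) := entropy_congr μ fun ω ω' => by
    simp only [Prod.mk.injEq]
    tauto
  have e3 : entropy μ (fun ω => (rvXS S ω, (rvYhS (D \ S) ω, rvYd ω), rvX0 ω, rvXS (D \ S) ω))
      = entropy μ (fun ω => (rvX0 ω, rvXS D ω, rvYd ω, rvYhS (D \ S) ω)) :=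
    entropy_congr μ fun ω ω' => by
      simp only [rvX0, rvXS, rvYd, rvYhS, Prod.mk.injEq, funext_iff, Subtype.forall,
        Finset.mem_sdiff]
      grind
  have e4 : entropy μ (fun ω => (rvYhS S ω, rvX0 ω, rvXS D ω, rvYd ω, rvYhS (D \ S) ω))
      = decodedEntropy μ D := entropy_congr μ fun ω ω' => by
    simp only [rvX0, rvXS, rvYd, rvYhS, Prod.mk.injEq, funext_iff, Subtype.forall,
      Finset.mem_sdiff]
    grind
  unfold cfGap condMI
  rw [e1, e2, e3, e4, hX, hY]
  ring

end Channel

/-- If `D₁ ⊆ N` and `D₂ ⊆ N` are both weakly decodable, then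
`D₁ ∪ D₂` is weakly decodable. -/
theorem weaklyDecodable_union
    {n : ℕ} {X0A YdA : Type} {XA YA YhA : Fin n → Type}
    [Fintype X0A] [DecidableEq X0A] [Fintype YdA] [DecidableEq YdA]
    [∀ i, Fintype (XA i)] [∀ i, DecidableEq (XA i)]
    [∀ i, Fintype (YA i)] [∀ i, DecidableEq (YA i)]
    [∀ i, Fintype (YhA i)] [∀ i, DecidableEq (YhA i)]
    (p0 : X0A → ℝ) (pX : ∀ i, XA i → ℝ)
    (W : X0A → (∀ i, XA i) → ((∀ i, YA i) × YdA) → ℝ)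
    (κ : ∀ i, YA i → XA i → YhA i → ℝ)
    (hp0 : ∀ x, 0 ≤ p0 x) (hp0s : ∑ x, p0 x = 1)
    (hpX : ∀ i x, 0 ≤ pX i x) (hpXs : ∀ i, ∑ x, pX i x = 1)
    (hW : ∀ x0 x y, 0 ≤ W x0 x y) (hWs : ∀ x0 x, ∑ y, W x0 x y = 1)
    (hκ : ∀ i y x yh, 0 ≤ κ i y x yh) (hκs : ∀ i y x, ∑ yh, κ i y x yh = 1)
    (D₁ D₂ : Finset (Fin n))
    (h₁ : WeaklyDecodable (muCF p0 pX W κ) D₁)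
    (h₂ : WeaklyDecodable (muCF p0 pX W κ) D₂) :
    WeaklyDecodable (muCF p0 pX W κ) (D₁ ∪ D₂) := by
  set μ := muCF p0 pX W κ with hμ_def
  have hμ : ∀ ω, 0 ≤ μ ω := muCF_nonneg hp0 hpX hW hκ
  set c : Fin n → ℝ := fun i => ∑ ω, μ ω * Real.log (pX i (ω.2.1 i))
    + ∑ ω, μ ω * Real.log (κ i (ω.2.2.1 i) (ω.2.1 i) (ω.2.2.2.2 i)) with hc
  set g : Finset (Fin n) → ℝ := fun A => decodedEntropy μ A + ∑ i ∈ A, c i with hg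
  have hgap : ∀ {D S : Finset (Fin n)}, S ⊆ D → cfGap μ D S = g (D \ S) - g D := by
    intro D S hS
    have h := Finset.sum_sdiff (f := c) hS
    have hcS : ∑ i ∈ S, c i = _ := Finset.sum_add_distrib
    rw [hμ_def, cfGap_eq hp0 hpX hpXs hW hWs hκ hκs hS]
    simp only [hg]
    linarith
  have hsub : ∀ A B, g (A ∪ B) + g (A ∩ B) ≤ g A + g B := fun A B => by
    have h := decodedEntropy_union_add_inter_le hμ A B
    have h' := Finset.sum_union_inter (s₁ := A) (s₂ := B) (f := c)
    simp only [hg]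
    linarith
  have hunion : ∀ {D}, WeaklyDecodable μ D → ∀ A, g (A ∪ D) ≤ g A := fun {D} hD A => by
    have h := hD (D \ A) Finset.sdiff_subset
    rw [hgap Finset.sdiff_subset, sdiff_sdiff_right_self, Finset.inf_eq_inter,
      Finset.inter_comm] at h
    linarith [hsub A D]
  intro S hS
  have h := (hunion h₂ _).trans (hunion h₁ ((D₁ ∪ D₂) \ S))
  rw [Finset.union_assoc, Finset.union_eq_right.mpr Finset.sdiff_subset] at h
  rw [hgap hS]
  linarith
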